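/- Fix γ, k ∈ (0,1) and a compact set B ⊂ ℝ^d. For z = (x,y) ∈ ℝ^d × {0,1} let l(β;z) = log[q·(1−γ)^y γ^{1−y} + (1−q)·(1−γ^k)^y γ^{k(1−y)}] with q = (1+e^{−xᵀβ})^{−1}. Assume the z_i = (x_i, y_i) are independent, sup_i E‖x_i‖² < ∞, there exists a continuous L : B → ℝ with sup_{β∈B}|E[m^{−1}Σ_{i=1}^m l(β;z_i)] − L(β)| → 0, and L has a unique global maximizer β* over B. Let β̂ be a measurable maximizer of m^{−1}Σ_{i=1}^m l(β;z_i) over B, and for a ∈ {0,1} and 1 ≤ j ≤ m let β̂(p_{j→a}) be a measurable maximizer over B of the same criterion with y_j replaced by a. Then β̂ → β* in probability, and moreover, for a = 0,1, sup_{1≤j≤m}‖β̂(p_{j→a}) − β*‖ → 0 in probability as m → ∞. -/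

import Mathlib

open MeasureTheory ProbabilityTheory Filter
open scoped BigOperators

noncomputable section

/-- Inner product `xᵀβ`. -/
def dotp {d : ℕ} (x β : EuclideanSpace ℝ (Fin d)) : ℝ := ∑ i, x i * β i

/-- The quasi log-likelihood term `l(β;(x,y))`. -/
def lfun {d : ℕ} (γ k : ℝ) (x : EuclideanSpace ℝ (Fin d)) (y : ℝ)
    (β : EuclideanSpace ℝ (Fin d)) : ℝ :=
  Real.log ((1 + Real.exp (-dotp x β))⁻¹ * ((1 - γ) ^ y * γ ^ (1 - y))
    + (1 - (1 + Real.exp (-dotp x β))⁻¹) * ((1 - γ ^ k) ^ y * γ ^ (k * (1 - y))))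

/-- `P_m l(β) = m⁻¹ Σ_{i<m} l(β; z_i)`. -/
def Pml {Ω : Type*} {d : ℕ} (γ k : ℝ) (x : ℕ → Ω → EuclideanSpace ℝ (Fin d))
    (y : ℕ → Ω → ℝ) (m : ℕ) (ω : Ω) (β : EuclideanSpace ℝ (Fin d)) : ℝ :=
  (m : ℝ)⁻¹ * ∑ i ∈ Finset.range m, lfun γ k (x i ω) (y i ω) β

/-- Leave-one-out criterion: the same as `P_m l` with the `j`-th response replaced by
`a ∈ {0,1}`. -/
def PmlLOO {Ω : Type*} {d : ℕ} (γ k : ℝ) (x : ℕ → Ω → EuclideanSpace ℝ (Fin d))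
    (y : ℕ → Ω → ℝ) (m : ℕ) (j : Fin m) (a : Fin 2) (ω : Ω)
    (β : EuclideanSpace ℝ (Fin d)) : ℝ :=
  (m : ℝ)⁻¹ * ∑ i : Fin m,
    lfun γ k (x i.1 ω) (if i = j then (a.1 : ℝ) else y i.1 ω) β

lemma aux_log_lip (c1 c2 s t : ℝ) (h1 : 0 < c1) (h2 : 0 < c2) :
    Real.log (c1 + c2 * Real.exp (-s)) ≤ |s - t| + Real.log (c1 + c2 * Real.exp (-t)) := by
  have hp : 0 < c1 + c2 * Real.exp (-t) := by positivity
  rw [← Real.log_exp |s - t|, ← Real.log_mul (Real.exp_pos _).ne' hp.ne']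
  apply Real.log_le_log (by positivity)
  have e1 : 1 ≤ Real.exp |s - t| := Real.one_le_exp (abs_nonneg _)
  have e2 : Real.exp (-s) ≤ Real.exp |s - t| * Real.exp (-t) := by
    rw [← Real.exp_add]
    apply Real.exp_le_exp.2
    have := neg_abs_le (s - t)
    linarith
  have : c1 ≤ c1 * Real.exp |s - t| := le_mul_of_one_le_right h1.le e1
  have : c2 * Real.exp (-s) ≤ c2 * (Real.exp |s - t| * Real.exp (-t)) :=
    mul_le_mul_of_nonneg_left e2 h2.le
  linarith

lemma aux_lfun_form {d : ℕ} (γ k : ℝ) (hγ : γ ∈ Set.Ioo (0:ℝ) 1) (hk : k ∈ Set.Ioo (0:ℝ) 1) :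
    ∃ a : ℝ, 0 < a ∧ ∀ y : ℝ, (y = 0 ∨ y = 1) → ∃ c1 c2 : ℝ, a ≤ c1 ∧ c1 ≤ 1 ∧ a ≤ c2 ∧ c2 ≤ 1 ∧
      ∀ x β : EuclideanSpace ℝ (Fin d), lfun γ k x y β =
        Real.log ((1 + Real.exp (-dotp x β))⁻¹ * c1
          + (1 - (1 + Real.exp (-dotp x β))⁻¹) * c2) := by
  obtain ⟨h0, h1⟩ := hγ
  have g0 : 0 < γ ^ k := Real.rpow_pos_of_pos h0 k
  have g1 : γ ^ k < 1 := Real.rpow_lt_one h0.le h1 hk.1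
  refine ⟨min (min γ (1 - γ)) (min (γ ^ k) (1 - γ ^ k)), ?_, ?_⟩
  · simp only [lt_min_iff]
    refine ⟨⟨h0, by linarith⟩, g0, by linarith⟩
  · rintro y (rfl | rfl)
    · refine ⟨γ, γ ^ k, by simp, h1.le, by simp, g1.le, fun x β => ?_⟩
      simp [lfun]
    · refine ⟨1 - γ, 1 - γ ^ k, by simp, by linarith, by simp, by linarith, fun x β => ?_⟩
      simp [lfun]

lemma aux_dotp {d : ℕ} (x β : EuclideanSpace ℝ (Fin d)) : dotp x β = inner ℝ x β := by
  simp [dotp, PiLp.inner_apply, mul_comm]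

lemma aux_lfun {d : ℕ} (γ k : ℝ) (hγ : γ ∈ Set.Ioo (0:ℝ) 1) (hk : k ∈ Set.Ioo (0:ℝ) 1) :
    ∃ M : ℝ, 0 ≤ M ∧ ∀ y : ℝ, (y = 0 ∨ y = 1) → ∀ x β : EuclideanSpace ℝ (Fin d),
      |lfun γ k x y β| ≤ M ∧
      ∀ β', lfun γ k x y β - lfun γ k x y β' ≤ (2 * ‖x‖) * ‖β - β'‖ := by
  obtain ⟨a, ha, H⟩ := aux_lfun_form (d := d) γ k hγ hk
  have hM : Real.log a ≤ |Real.log a| := le_abs_self _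
  refine ⟨|Real.log a|, abs_nonneg _, fun y hy x β => ?_⟩
  obtain ⟨c1, c2, h1, h1', h2, h2', hl⟩ := H y hy
  constructor
  · rw [hl]
    set q := (1 + Real.exp (-dotp x β))⁻¹ with hq
    have he := Real.exp_pos (-dotp x β)
    have q0 : 0 ≤ q := by positivity
    have q1 : q ≤ 1 := inv_le_one_of_one_le₀ (by linarith)
    have lo : a ≤ q * c1 + (1 - q) * c2 := by nlinarith
    have hi : q * c1 + (1 - q) * c2 ≤ 1 := by nlinarith
    have l1 := Real.log_le_log ha lo
    have l2 := Real.log_nonpos (ha.le.trans lo) hi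
    rw [abs_of_nonpos l2, abs_of_nonpos (l1.trans l2)]
    linarith
  · intro β'
    have form : ∀ β, lfun γ k x y β = Real.log (c1 + c2 * Real.exp (-dotp x β))
        - Real.log (1 + 1 * Real.exp (-dotp x β)) := by
      intro β
      have he := Real.exp_pos (-dotp x β)
      have p1 : 0 < c1 := ha.trans_le h1
      have p2 : 0 < c2 := ha.trans_le h2
      rw [hl, ← Real.log_div (by positivity) (by positivity)]
      congr 1
      field_simp
      ring
    have A := aux_log_lip c1 c2 (dotp x β) (dotp x β') (ha.trans_le h1) (ha.trans_le h2)
    have A' := aux_log_lip 1 1 (dotp x β') (dotp x β) one_pos one_pos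
    have Bd : |dotp x β - dotp x β'| ≤ ‖x‖ * ‖β - β'‖ := by
      rw [aux_dotp, aux_dotp, ← inner_sub_right]
      exact abs_real_inner_le_norm _ _
    rw [abs_sub_comm] at A'
    rw [form, form]
    linarith

lemma aux_meas {d : ℕ} (γ k : ℝ) (β : EuclideanSpace ℝ (Fin d)) :
    Measurable (fun z : EuclideanSpace ℝ (Fin d) × ℝ => lfun γ k z.1 z.2 β) := by
  unfold lfun
  simp only [aux_dotp]
  have : Measurable (fun z : EuclideanSpace ℝ (Fin d) × ℝ => (inner ℝ z.1 β : ℝ)) :=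
    (continuous_fst.inner continuous_const).measurable
  fun_prop

lemma aux_wlln {Ω : Type*} [MeasurableSpace Ω] (μ : Measure Ω) [IsProbabilityMeasure μ]
    (f : ℕ → Ω → ℝ) (M : ℝ) (hf : ∀ i ω, |f i ω| ≤ M) (hm : ∀ i, Measurable (f i))
    (hi : iIndepFun f μ) (η : ℝ) (hη : 0 < η) :
    Tendsto (fun m : ℕ => μ.real {ω | η ≤ |(m:ℝ)⁻¹ * ∑ i ∈ Finset.range m, f i ω
      - ∫ ω, (m:ℝ)⁻¹ * ∑ i ∈ Finset.range m, f i ω ∂μ|}) atTop (nhds 0) := by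
  have hL : ∀ i, MemLp (f i) 2 μ := fun i =>
    MemLp.of_bound (hm i).aestronglyMeasurable M (ae_of_all _ (fun ω => hf i ω))
  have hub : ∀ m : ℕ, 0 < m → μ.real {ω | η ≤ |(m:ℝ)⁻¹ * ∑ i ∈ Finset.range m, f i ω
      - ∫ ω, (m:ℝ)⁻¹ * ∑ i ∈ Finset.range m, f i ω ∂μ|} ≤ M ^ 2 / η ^ 2 * (m:ℝ)⁻¹ := by
    intro m hm0
    have hS : MemLp (fun ω => (m:ℝ)⁻¹ * ∑ i ∈ Finset.range m, f i ω) 2 μ :=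
      (memLp_finsetSum _ (fun i _ => hL i)).const_mul _
    have h := meas_ge_le_variance_div_sq hS hη
    have hv : variance (fun ω => (m:ℝ)⁻¹ * ∑ i ∈ Finset.range m, f i ω) μ ≤ M ^ 2 * (m:ℝ)⁻¹ := by
      rw [variance_const_mul]
      have e : (fun ω => ∑ i ∈ Finset.range m, f i ω) = ∑ i ∈ Finset.range m, f i := by
        ext ω; simp
      rw [e, IndepFun.variance_sum (fun i _ => hL i) (fun i _ j _ hij => hi.indepFun hij)]
      have : ∑ i ∈ Finset.range m, variance (f i) μ ≤ ∑ i ∈ Finset.range m, M ^ 2 := by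
        apply Finset.sum_le_sum
        intro i _
        have := variance_le_sq_of_bounded (μ := μ) (a := -M) (b := M) (X := f i)
          (ae_of_all _ (fun ω => abs_le.1 (hf i ω))) (hm i).aemeasurable
        have e : M ^ 2 = ((M - -M) / 2) ^ 2 := by ring
        rw [e]
        exact this
      rw [Finset.sum_const, Finset.card_range, nsmul_eq_mul] at this
      calc _ ≤ ((m:ℝ)⁻¹) ^ 2 * (m * M ^ 2) := by gcongr
        _ = M ^ 2 * (m:ℝ)⁻¹ := by
          have : (m:ℝ) ≠ 0 := by positivity
          field_simp
    have h' := ENNReal.toReal_mono (by simp) h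
    rw [ENNReal.toReal_ofReal (div_nonneg (variance_nonneg _ _) (sq_nonneg _))] at h'
    refine h'.trans ?_
    calc _ ≤ (M ^ 2 * (m:ℝ)⁻¹) / η ^ 2 := by gcongr
      _ = _ := by ring
  have hz : Tendsto (fun m : ℕ => M ^ 2 / η ^ 2 * (m:ℝ)⁻¹) atTop (nhds 0) := by
    simpa using (tendsto_inv_atTop_nhds_zero_nat (𝕜 := ℝ)).const_mul (M ^ 2 / η ^ 2)
  refine tendsto_of_tendsto_of_tendsto_of_le_of_le' tendsto_const_nhds hz
    (Eventually.of_forall fun _ => measureReal_nonneg) ?_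
  filter_upwards [eventually_gt_atTop 0] with m h using hub m h

lemma aux_ulln {Ω E : Type*} [MeasurableSpace Ω] [NormedAddCommGroup E]
    (μ : Measure Ω) [IsProbabilityMeasure μ]
    (B : Set E) (hB : IsCompact B)
    (f : ℕ → Ω → E → ℝ) (g : ℕ → Ω → ℝ) (M C : ℝ) (hf : ∀ i ω β, |f i ω β| ≤ M)
    (hm : ∀ i β, Measurable (fun ω => f i ω β))
    (hi : ∀ β, iIndepFun (fun i ω => f i ω β) μ)
    (hg0 : ∀ i ω, 0 ≤ g i ω) (hg : ∀ i, Integrable (g i) μ) (hgC : ∀ i, ∫ ω, g i ω ∂μ ≤ C)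
    (hlip : ∀ i ω β β', f i ω β - f i ω β' ≤ g i ω * ‖β - β'‖)
    (η : ℝ) (hη : 0 < η) :
    Tendsto (fun m : ℕ => μ.real {ω | ∃ β ∈ B, η ≤ |(m:ℝ)⁻¹ * ∑ i ∈ Finset.range m, f i ω β
      - ∫ ω, (m:ℝ)⁻¹ * ∑ i ∈ Finset.range m, f i ω β ∂μ|}) atTop (nhds 0) := by
  have hC : 0 ≤ C := (integral_nonneg (hg0 0)).trans (hgC 0)
  set F : ℕ → Ω → E → ℝ := fun m ω β => (m:ℝ)⁻¹ * ∑ i ∈ Finset.range m, f i ω β with hF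
  set A : ℕ → Ω → ℝ := fun m ω => (m:ℝ)⁻¹ * ∑ i ∈ Finset.range m, g i ω with hA
  have hAint : ∀ m, Integrable (A m) μ := fun m =>
    (integrable_finsetSum _ (fun i _ => hg i)).const_mul _
  have hA0 : ∀ m ω, 0 ≤ A m ω := fun m ω =>
    mul_nonneg (by positivity) (Finset.sum_nonneg fun i _ => hg0 i ω)
  have hAC : ∀ m, ∫ ω, A m ω ∂μ ≤ C := by
    intro m
    simp only [hA]
    rw [integral_const_mul, integral_finsetSum _ (fun i _ => hg i)]
    rcases Nat.eq_zero_or_pos m with rfl | h0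
    · simpa using hC
    have : ∑ i ∈ Finset.range m, ∫ ω, g i ω ∂μ ≤ ∑ i ∈ Finset.range m, C :=
      Finset.sum_le_sum fun i _ => hgC i
    rw [Finset.sum_const, Finset.card_range, nsmul_eq_mul] at this
    rw [inv_mul_le_iff₀ (by positivity)]
    exact this
  have hFint : ∀ m β, Integrable (fun ω => F m ω β) μ := by
    intro m β
    refine Integrable.const_mul (integrable_finsetSum _ (fun i _ => ?_)) _
    exact Integrable.of_bound (hm i β).aestronglyMeasurable M (ae_of_all _ fun ω => hf i ω β)
  have hFlip : ∀ m ω β β', F m ω β - F m ω β' ≤ A m ω * ‖β - β'‖ := by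
    intro m ω β β'
    simp only [hF, hA]
    rw [← mul_sub, ← Finset.sum_sub_distrib, mul_assoc, Finset.sum_mul]
    gcongr with i _
    exact hlip i ω β β'
  have hIlip : ∀ m β β', (∫ ω, F m ω β ∂μ) - ∫ ω, F m ω β' ∂μ ≤ C * ‖β - β'‖ := by
    intro m β β'
    rw [← integral_sub (hFint m β) (hFint m β')]
    calc _ ≤ ∫ ω, A m ω * ‖β - β'‖ ∂μ := by
          apply integral_mono ((hFint m β).sub (hFint m β')) ((hAint m).mul_const _)
          intro ω; exact hFlip m ω β β'
      _ = (∫ ω, A m ω ∂μ) * ‖β - β'‖ := integral_mul_const _ _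
      _ ≤ _ := by gcongr; exact hAC m
  rw [Metric.tendsto_atTop']
  intro ρ hρ
  set K : ℝ := (C + 1) / (ρ / 2) with hK
  have hKpos : 0 < K := by positivity
  set δ : ℝ := (η / 2) / (K + C) with hδ
  have hδpos : 0 < δ := by positivity
  have hδe : (K + C) * δ = η / 2 := by rw [hδ]; field_simp
  obtain ⟨t, htB, htf, htc⟩ := hB.finite_cover_balls hδpos
  have hsum : Tendsto (fun m : ℕ => ∑ c ∈ htf.toFinset, μ.real {ω | η / 2 ≤ |F m ω c
      - ∫ ω, F m ω c ∂μ|}) atTop (nhds 0) := by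
    have := tendsto_finsetSum htf.toFinset (fun c _ => aux_wlln μ (fun i ω => f i ω c) M
      (fun i ω => hf i ω c) (fun i => hm i c) (hi c) (η / 2) (by positivity))
    simpa using this
  obtain ⟨N, hN⟩ := (Metric.tendsto_atTop'.1 hsum) (ρ / 2) (by positivity)
  refine ⟨N, fun m hmN => ?_⟩
  have h1 := hN m hmN
  rw [Real.dist_0_eq_abs, abs_of_nonneg (Finset.sum_nonneg fun _ _ => measureReal_nonneg)] at h1
  rw [Real.dist_0_eq_abs, abs_of_nonneg measureReal_nonneg]
  have hAK : μ.real {ω | K ≤ A m ω} < ρ / 2 := by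
    have := mul_meas_ge_le_integral_of_nonneg (ae_of_all _ (hA0 m)) (hAint m) K
    have h2 := this.trans (hAC m)
    rw [← le_div_iff₀' hKpos] at h2
    refine h2.trans_lt ?_
    rw [div_lt_iff₀ hKpos, hK]
    field_simp
    linarith
  have hsub : {ω | ∃ β ∈ B, η ≤ |F m ω β - ∫ ω, F m ω β ∂μ|} ⊆
      {ω | K ≤ A m ω} ∪ ⋃ c ∈ htf.toFinset, {ω | η / 2 ≤ |F m ω c - ∫ ω, F m ω c ∂μ|} := by
    rintro ω ⟨β, hβ, hle⟩
    by_contra hcon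
    simp only [Set.mem_union, Set.mem_ofPred_eq, Set.mem_iUnion, not_or, not_exists, not_le,
      Set.Finite.mem_toFinset] at hcon
    obtain ⟨hk, hc⟩ := hcon
    obtain ⟨c, hct, hcb⟩ := Set.mem_iUnion₂.1 (htc hβ)
    rw [Metric.mem_ball, dist_eq_norm] at hcb
    have hcb' : ‖c - β‖ < δ := by rwa [norm_sub_rev]
    have q1 := hFlip m ω β c
    have q2 := hFlip m ω c β
    have q3 := hIlip m β c
    have q4 := hIlip m c β
    have w1 : A m ω * ‖β - c‖ ≤ K * δ := by gcongr
    have w2 : A m ω * ‖c - β‖ ≤ K * δ := by gcongr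
    have w3 : C * ‖β - c‖ ≤ C * δ := by gcongr
    have w4 : C * ‖c - β‖ ≤ C * δ := by gcongr
    have h3 := abs_lt.1 (hc c hct)
    have : |F m ω β - ∫ ω, F m ω β ∂μ| < η := by
      rw [abs_lt]
      constructor <;> linarith [h3.1, h3.2]
    linarith
  calc _ ≤ _ := measureReal_mono hsub
    _ ≤ _ := measureReal_union_le _ _
    _ ≤ μ.real {ω | K ≤ A m ω} + _ := add_le_add le_rfl (measureReal_biUnion_finset_le _ _)
    _ < ρ := by linarith

lemma aux_sep {E : Type*} [NormedAddCommGroup E] (B : Set E) (hB : IsCompact B) (L : E → ℝ)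
    (hL : ContinuousOn L B) (b : E) (hmax : ∀ β ∈ B, L β ≤ L b)
    (huniq : ∀ β ∈ B, L β = L b → β = b) (ε : ℝ) (hε : 0 < ε) :
    ∃ η > 0, ∀ β ∈ B, ε ≤ ‖β - b‖ → L β + η ≤ L b := by
  have hc : IsCompact (B ∩ {β | ε ≤ ‖β - b‖}) :=
    hB.inter_right (isClosed_le continuous_const (by fun_prop))
  rcases Set.eq_empty_or_nonempty (B ∩ {β | ε ≤ ‖β - b‖}) with h | h
  · refine ⟨1, one_pos, fun β hβ h' => ?_⟩
    have : β ∈ B ∩ {β | ε ≤ ‖β - b‖} := ⟨hβ, h'⟩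
    simp [h] at this
  · obtain ⟨c, hcm, hcmax⟩ := hc.exists_isMaxOn h (hL.mono Set.inter_subset_left)
    refine ⟨L b - L c, ?_, fun β hβ h' => ?_⟩
    · have h1 := hmax c hcm.1
      have h2 : L c ≠ L b := fun h => by
        have h3 := huniq c hcm.1 h
        have h4 : ε ≤ ‖c - b‖ := hcm.2
        rw [h3, sub_self, norm_zero] at h4
        linarith
      have := lt_of_le_of_ne h1 h2
      linarith
    · have h3 : L β ≤ L c := hcmax (a := β) ⟨hβ, h'⟩
      linarith

lemma aux_loo {Ω : Type*} {d : ℕ} (γ k : ℝ) (x : ℕ → Ω → EuclideanSpace ℝ (Fin d))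
    (y : ℕ → Ω → ℝ) (M : ℝ) (hy01 : ∀ i ω, y i ω = 0 ∨ y i ω = 1)
    (hb : ∀ y : ℝ, (y = 0 ∨ y = 1) → ∀ x β : EuclideanSpace ℝ (Fin d), |lfun γ k x y β| ≤ M)
    (m : ℕ) (j : Fin m) (a : Fin 2) (ω : Ω) (β : EuclideanSpace ℝ (Fin d)) :
    |PmlLOO γ k x y m j a ω β - Pml γ k x y m ω β| ≤ 2 * M * (m:ℝ)⁻¹ := by
  unfold PmlLOO Pml
  rw [← Fin.sum_univ_eq_sum_range (fun i => lfun γ k (x i ω) (y i ω) β) m, ← mul_sub,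
    ← Finset.sum_sub_distrib, Finset.sum_eq_single j]
  · rw [abs_mul, abs_of_nonneg (by positivity : (0:ℝ) ≤ (m:ℝ)⁻¹), mul_comm]
    gcongr
    simp only [if_true]
    have h1 := hb (a.1 : ℝ) (by fin_cases a <;> simp) (x j ω) β
    have h2 := hb (y j ω) (hy01 _ _) (x j ω) β
    rw [abs_le] at *
    constructor <;> linarith
  · intro i _ hij
    simp [hij]
  · simp

lemma aux_meas2 {Ω : Type*} [MeasurableSpace Ω] {d : ℕ} (γ k : ℝ) (β : EuclideanSpace ℝ (Fin d))
    (x : Ω → EuclideanSpace ℝ (Fin d)) (y : Ω → ℝ) (hx : Measurable x) (hy : Measurable y) :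
    Measurable (fun ω => lfun γ k (x ω) (y ω) β) := by
  have h : Measurable (fun ω => (x ω, y ω)) := hx.prodMk hy
  exact Measurable.comp (g := fun z : EuclideanSpace ℝ (Fin d) × ℝ => lfun γ k z.1 z.2 β)
    (f := fun ω => (x ω, y ω)) (aux_meas γ k β) h

lemma aux_indep2 {Ω : Type*} [MeasurableSpace Ω] (μ : Measure Ω) {d : ℕ} (γ k : ℝ)
    (β : EuclideanSpace ℝ (Fin d))
    (x : ℕ → Ω → EuclideanSpace ℝ (Fin d)) (y : ℕ → Ω → ℝ)
    (hindep : iIndepFun (fun i ω => (x i ω, y i ω)) μ) :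
    iIndepFun (fun i ω => lfun γ k (x i ω) (y i ω) β) μ := by
  exact iIndepFun.comp hindep
    (fun _ (z : EuclideanSpace ℝ (Fin d) × ℝ) => lfun γ k z.1 z.2 β) (fun _ => aux_meas γ k β)

set_option maxHeartbeats 400000 in
/-- consistency of the quasi-MLE and uniform consistency of the leave-one-out
quasi-MLEs: `β̂ → β*` and `sup_{j≤m} ‖β̂(p_{j→a}) − β*‖ → 0` in probability. -/
theorem stmt_5 {Ω : Type*} [MeasurableSpace Ω] (μ : Measure Ω) [IsProbabilityMeasure μ]
    {d : ℕ} (γ k : ℝ) (hγ : γ ∈ Set.Ioo (0:ℝ) 1) (hk : k ∈ Set.Ioo (0:ℝ) 1)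
    (B : Set (EuclideanSpace ℝ (Fin d))) (hB : IsCompact B)
    (x : ℕ → Ω → EuclideanSpace ℝ (Fin d)) (y : ℕ → Ω → ℝ)
    (hxmeas : ∀ i, Measurable (x i)) (hymeas : ∀ i, Measurable (y i))
    (hy01 : ∀ i ω, y i ω = 0 ∨ y i ω = 1)
    (hindep : iIndepFun (fun i ω => (x i ω, y i ω)) μ)
    (hmomInt : ∀ i, Integrable (fun ω => ‖x i ω‖ ^ 2) μ)
    (hmom : ∃ C : ℝ, ∀ i, (∫ ω, ‖x i ω‖ ^ 2 ∂μ) ≤ C)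
    (L : EuclideanSpace ℝ (Fin d) → ℝ) (hLcont : ContinuousOn L B)
    (hmean : Tendsto (fun m : ℕ =>
        ⨆ β : B, |(∫ ω, Pml γ k x y m ω β.1 ∂μ) - L β.1|) atTop (nhds 0))
    (βstar : EuclideanSpace ℝ (Fin d)) (hβstarB : βstar ∈ B)
    (hβstarMax : ∀ β ∈ B, L β ≤ L βstar)
    (hβstarUniq : ∀ β ∈ B, L β = L βstar → β = βstar)
    (βhat : ℕ → Ω → EuclideanSpace ℝ (Fin d))
    (hβhatMeas : ∀ m, Measurable (βhat m))
    (hβhatMax : ∀ m ω, βhat m ω ∈ B ∧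
      ∀ β ∈ B, Pml γ k x y m ω β ≤ Pml γ k x y m ω (βhat m ω))
    (βhatL : (m : ℕ) → Fin m → Fin 2 → Ω → EuclideanSpace ℝ (Fin d))
    (hβhatLMeas : ∀ m j a, Measurable (βhatL m j a))
    (hβhatLMax : ∀ m (j : Fin m) (a : Fin 2) ω, βhatL m j a ω ∈ B ∧
      ∀ β ∈ B, PmlLOO γ k x y m j a ω β ≤ PmlLOO γ k x y m j a ω (βhatL m j a ω)) :
    (∀ ε > (0:ℝ), Tendsto (fun m : ℕ =>
        (μ {ω | ε < ‖βhat m ω - βstar‖}).toReal) atTop (nhds 0)) ∧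
    (∀ a : Fin 2, ∀ ε > (0:ℝ), Tendsto (fun m : ℕ =>
        (μ {ω | ε < ⨆ j : Fin m, ‖βhatL m j a ω - βstar‖}).toReal) atTop (nhds 0)) := by
  obtain ⟨M, hM0, hl⟩ := aux_lfun (d := d) γ k hγ hk
  have hfb : ∀ y : ℝ, (y = 0 ∨ y = 1) → ∀ x β : EuclideanSpace ℝ (Fin d),
      |lfun γ k x y β| ≤ M := fun y hy x β => (hl y hy x β).1
  obtain ⟨C, hC⟩ := hmom
  have hxi : ∀ i, Integrable (fun ω => 2 * ‖x i ω‖) μ := by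
    intro i
    refine Integrable.mono' ((integrable_const (1:ℝ)).add (hmomInt i))
      ((hxmeas i).norm.const_mul 2).aestronglyMeasurable (ae_of_all _ fun ω => ?_)
    simp only [Pi.add_apply, Real.norm_eq_abs, abs_mul, abs_norm]
    rw [abs_of_pos (by norm_num : (0:ℝ) < 2)]
    nlinarith [sq_nonneg (‖x i ω‖ - 1)]
  have hxC : ∀ i, ∫ ω, 2 * ‖x i ω‖ ∂μ ≤ 1 + C := by
    intro i
    calc _ ≤ ∫ ω, (1 + ‖x i ω‖ ^ 2) ∂μ := by
          apply integral_mono (hxi i) ((integrable_const (1:ℝ)).add (hmomInt i))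
          intro ω
          simp only [Pi.add_apply]
          nlinarith [sq_nonneg (‖x i ω‖ - 1)]
      _ = 1 + ∫ ω, ‖x i ω‖ ^ 2 ∂μ := by
          rw [integral_add (integrable_const _) (hmomInt i)]; simp
      _ ≤ _ := by linarith [hC i]
  have hme : ∀ (i : ℕ) (β : EuclideanSpace ℝ (Fin d)),
      Measurable (fun ω => lfun γ k (x i ω) (y i ω) β) := fun i β =>
    aux_meas2 γ k β (x i) (y i) (hxmeas i) (hymeas i)
  have hin : ∀ β : EuclideanSpace ℝ (Fin d),
      iIndepFun (fun i ω => lfun γ k (x i ω) (y i ω) β) μ := fun β =>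
    aux_indep2 μ γ k β x y hindep
  have hg0 : ∀ i ω, 0 ≤ 2 * ‖x i ω‖ := fun i ω => by positivity
  have hbb : ∀ i ω β, |lfun γ k (x i ω) (y i ω) β| ≤ M := fun i ω β => hfb _ (hy01 i ω) _ _
  have hlip : ∀ i ω β β', lfun γ k (x i ω) (y i ω) β - lfun γ k (x i ω) (y i ω) β' ≤
      (2 * ‖x i ω‖) * ‖β - β'‖ := fun i ω β β' => (hl _ (hy01 i ω) _ β).2 β'
  have hU := aux_ulln μ B hB (fun i ω β => lfun γ k (x i ω) (y i ω) β) (fun i ω => 2 * ‖x i ω‖)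
    M (1 + C) hbb hme hin hg0 hxi hxC hlip
  change ∀ η : ℝ, 0 < η → Tendsto (fun m : ℕ => μ.real {ω | ∃ β ∈ B,
    η ≤ |Pml γ k x y m ω β - ∫ ω, Pml γ k x y m ω β ∂μ|}) atTop (nhds 0) at hU
  have hPb : ∀ m ω β, |Pml γ k x y m ω β| ≤ M := by
    intro m ω β
    unfold Pml
    rcases Nat.eq_zero_or_pos m with rfl | h0
    · simpa using hM0
    rw [abs_mul, abs_of_nonneg (by positivity : (0:ℝ) ≤ (m:ℝ)⁻¹),
      inv_mul_le_iff₀ (by positivity)]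
    refine (Finset.abs_sum_le_sum_abs _ _).trans ?_
    refine (Finset.sum_le_sum (fun i _ => hfb _ (hy01 i ω) (x i ω) β)).trans ?_
    simp
  obtain ⟨ML, hML⟩ := hB.exists_bound_of_continuousOn hLcont
  have hbdd : ∀ m, BddAbove (Set.range fun β : B =>
      |(∫ ω, Pml γ k x y m ω β.1 ∂μ) - L β.1|) := by
    intro m
    refine ⟨M + ML, ?_⟩
    rintro _ ⟨β, rfl⟩
    have h1 : ‖∫ ω, Pml γ k x y m ω β.1 ∂μ‖ ≤ M := by
      simpa using norm_integral_le_of_norm_le_const (μ := μ)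
        (f := fun ω => Pml γ k x y m ω β.1) (C := M)
        (ae_of_all _ (fun ω => hPb m ω β.1))
    have h2 := hML β.1 β.2
    exact (norm_sub_le _ _).trans (add_le_add h1 h2)
  have key : ∀ ε > (0:ℝ), ∃ S : ℕ → Set Ω, Tendsto (fun m => μ.real (S m)) atTop (nhds 0) ∧
      ∀ᶠ m in atTop, ∀ ω, ω ∉ S m → ‖βhat m ω - βstar‖ ≤ ε ∧
        ∀ j a, ‖βhatL m j a ω - βstar‖ ≤ ε := by
    intro ε hε
    obtain ⟨η, hη, hsep⟩ := aux_sep B hB L hLcont βstar hβstarMax hβstarUniq ε hε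
    refine ⟨_, hU (η / 8) (by positivity), ?_⟩
    have hz : Tendsto (fun m : ℕ => 2 * M * (m:ℝ)⁻¹) atTop (nhds 0) := by
      simpa using (tendsto_inv_atTop_nhds_zero_nat (𝕜 := ℝ)).const_mul (2 * M)
    filter_upwards [hmean.eventually_lt_const (show (0:ℝ) < η / 8 by positivity),
      hz.eventually_lt_const (show (0:ℝ) < η / 8 by positivity)] with m hm1 hm2 ω hω
    simp only [Set.mem_ofPred_eq, not_exists, not_and, not_le] at hω
    have hPL : ∀ β ∈ B, |Pml γ k x y m ω β - L β| < η / 4 := by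
      intro β hβ
      have h1 := abs_lt.1 (hω β hβ)
      have h2 := abs_lt.1 ((le_ciSup (hbdd m) ⟨β, hβ⟩).trans_lt hm1)
      rw [abs_lt]
      constructor <;> linarith [h1.1, h1.2, h2.1, h2.2]
    have fin : ∀ (G : EuclideanSpace ℝ (Fin d) → ℝ) (b : EuclideanSpace ℝ (Fin d)),
        (∀ β ∈ B, |G β - L β| < η / 2) → b ∈ B → (∀ β ∈ B, G β ≤ G b) → ‖b - βstar‖ ≤ ε := by
      intro G b hG hb hmx
      by_contra hcon
      have h1 := hsep b hb (not_le.1 hcon).le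
      have h2 := hmx βstar hβstarB
      have h3 := abs_lt.1 (hG b hb)
      have h4 := abs_lt.1 (hG βstar hβstarB)
      linarith [h3.1, h3.2, h4.1, h4.2]
    refine ⟨fin _ _ (fun β hβ => (hPL β hβ).trans (by linarith)) (hβhatMax m ω).1
      (hβhatMax m ω).2, fun j a => fin _ _ (fun β hβ => ?_) (hβhatLMax m j a ω).1
      (hβhatLMax m j a ω).2⟩
    have h1 := abs_lt.1 (hPL β hβ)
    have h2 := abs_le.1 (aux_loo γ k x y M hy01 hfb m j a ω β)
    rw [abs_lt]
    constructor <;> linarith [h1.1, h1.2, h2.1, h2.2]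
  constructor
  · intro ε hε
    obtain ⟨S, hS, hev⟩ := key ε hε
    refine tendsto_of_tendsto_of_tendsto_of_le_of_le' tendsto_const_nhds hS
      (Eventually.of_forall fun _ => ENNReal.toReal_nonneg) ?_
    filter_upwards [hev] with m hm
    refine measureReal_mono (μ := μ) (fun ω hω => ?_)
    by_contra hcon
    exact absurd (hm ω hcon).1 (not_le.2 hω)
  · intro a ε hε
    obtain ⟨S, hS, hev⟩ := key ε hε
    refine tendsto_of_tendsto_of_tendsto_of_le_of_le' tendsto_const_nhds hS
      (Eventually.of_forall fun _ => ENNReal.toReal_nonneg) ?_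
    filter_upwards [hev] with m hm
    refine measureReal_mono (μ := μ) (fun ω hω => ?_)
    by_contra hcon
    exact absurd (Real.iSup_le (fun j => (hm ω hcon).2 j a) hε.le) (not_le.2 hω)
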